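/- arXiv:1811.04623 — 2 statements merged into one kernel-verified Lean document; each statement's English description precedes it below -/
import Mathlib

section
/- For p̂ > 0, define g : ℝ → ℝ by g(q) = -log q + (q/p̂)·log(q/p̂). Then for all q with 0 < q < p̂ one has g'(q) < 0, and for all q with p̂ < q one has g'(q) > 0. -/
theorem hasDerivAt_neg_log_add_div_mul_log_div {p q : ℝ} (hp : 0 < p) (hq : 0 < q) :
    HasDerivAt (fun x : ℝ => -Real.log x + (x / p) * Real.log (x / p))
      (-q⁻¹ + (Real.log (q / p) + 1) * p⁻¹) q := by
  have hdiv : HasDerivAt (fun x : ℝ => x / p) (1 / p) q := (hasDerivAt_id' q).div_const p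
  have hlog := hdiv.log (div_pos hq hp).ne'
  refine ((Real.hasDerivAt_log hq.ne').fun_neg.fun_add (hdiv.fun_mul hlog)).congr_deriv ?_
  field_simp

/-- Sign of the fine-tuning gradient: for
`g q = -log q + (q/p̂) * log (q/p̂)` with `p̂ > 0`, `g' q < 0` for `0 < q < p̂`
and `g' q > 0` for `q > p̂`. -/
theorem deriv_finetune_loss_sign
    (phat : ℝ) (hphat : 0 < phat)
    (g : ℝ → ℝ)
    (hg : ∀ q : ℝ, g q = -Real.log q + (q / phat) * Real.log (q / phat)) :
    (∀ q : ℝ, 0 < q → q < phat → deriv g q < 0) ∧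
    (∀ q : ℝ, phat < q → 0 < deriv g q) := by
  obtain rfl : g = fun q => -Real.log q + (q / phat) * Real.log (q / phat) := funext hg
  have hinv : 0 < phat⁻¹ := inv_pos.mpr hphat
  constructor
  · intro q hq hlt
    rw [(hasDerivAt_neg_log_add_div_mul_log_div hphat hq).deriv]
    have hlog : Real.log (q / phat) < 0 :=
      Real.log_neg (div_pos hq hphat) ((div_lt_one hphat).mpr hlt)
    have hlt' : phat⁻¹ < q⁻¹ := inv_strictAnti₀ hq hlt
    linarith [mul_neg_of_neg_of_pos hlog hinv]
  · intro q hlt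
    rw [(hasDerivAt_neg_log_add_div_mul_log_div hphat (hphat.trans hlt)).deriv]
    have hlog : 0 < Real.log (q / phat) := Real.log_pos ((one_lt_div hphat).mpr hlt)
    have hlt' : q⁻¹ < phat⁻¹ := inv_strictAnti₀ hphat hlt
    linarith [mul_pos hlog hinv]
end

section
/- Let W be a nonempty finite type and let p, q₀, q : W → ℝ be probability mass functions with p(w) > 0 and q₀(w) > 0 for all w ∈ W. For each w define r(w) = q₀(w)/(q₀(w) + p(w)) and t(w) = (q(w)/q₀(w))·(r(w)/(1 - r(w))). Then ∑_{w ∈ W} p(w)·t(w)·log(t(w)) = ∑_{w ∈ W} q(w)·log(q(w)/p(w)), with the convention that a summand with t(w) = 0 (equivalently q(w) = 0) is 0. -/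
open Finset

/-- Equations (10)–(11): with the optimal discriminator
`r w = q₀ w / (q₀ w + p w)` and `t w = (q w / q₀ w) * (r w / (1 - r w))`,
the estimator `∑ p w * t w * log (t w)` equals the reverse KL divergence
`∑ q w * log (q w / p w)`. (Summands with `t w = 0` are `0`, automatic since
`Real.log 0 = 0`.) -/
theorem reverse_kl_estimator_exact
    {W : Type*} [Fintype W] [Nonempty W]
    (p q₀ q : W → ℝ)
    (hp : ∀ w, 0 < p w) (hpsum : ∑ w, p w = 1)
    (hq₀ : ∀ w, 0 < q₀ w) (hq₀sum : ∑ w, q₀ w = 1)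
    (hq : ∀ w, 0 ≤ q w) (hqsum : ∑ w, q w = 1)
    (r t : W → ℝ)
    (hr : ∀ w, r w = q₀ w / (q₀ w + p w))
    (ht : ∀ w, t w = (q w / q₀ w) * (r w / (1 - r w))) :
    ∑ w, p w * (t w * Real.log (t w)) = ∑ w, q w * Real.log (q w / p w) := by
  refine Finset.sum_congr rfl fun w _ => ?_
  have hp' := (hp w).ne'
  have hq₀' := (hq₀ w).ne'
  have hs : q₀ w + p w ≠ 0 := (add_pos (hq₀ w) (hp w)).ne'
  have hr' : 1 - r w = p w / (q₀ w + p w) := by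
    rw [hr, one_sub_div hs, add_sub_cancel_left]
  have ht' : t w = q w / p w := by
    rw [ht, hr', hr, div_div_div_cancel_right₀ hs, div_mul_div_cancel₀ hq₀']
  rw [ht', ← mul_assoc, mul_div_cancel₀ _ hp']
end
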